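/- arXiv:2604.01143 — 2 statements merged into one kernel-verified Lean document; each statement's English description precedes it below -/
import Mathlib

section
/- For every k ≥ 1 and every n ≥ k + 2, the number of permutations of length n with exactly k inversions that avoid both 1324 and 2143 equals 2·p(k), where p(k) is the number of integer partitions of k. -/
/-- A permutation `π` of length `n` (as a bijection of `Fin n`, position `i` has value `π i`)
contains the pattern `p` of length `m` if some subsequence of `π` is order-isomorphic to `p`. -/
def Contains {n m : ℕ} (π : Equiv.Perm (Fin n)) (p : Equiv.Perm (Fin m)) : Prop :=
  ∃ f : Fin m → Fin n, StrictMono f ∧ ∀ a b : Fin m, π (f a) < π (f b) ↔ p a < p b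

/-- `π` avoids the pattern `p`. -/
def Avoids {n m : ℕ} (π : Equiv.Perm (Fin n)) (p : Equiv.Perm (Fin m)) : Prop :=
  ¬ Contains π p

/-- The number of inversions of `π`: pairs of positions `i < j` with `π i > π j`. -/
noncomputable def invCount {n : ℕ} (π : Equiv.Perm (Fin n)) : ℕ :=
  Nat.card {ij : Fin n × Fin n // ij.1 < ij.2 ∧ π ij.2 < π ij.1}

def p1324 : Equiv.Perm (Fin 4) := ⟨![0,2,1,3], ![0,2,1,3], by decide, by decide⟩
def p2143 : Equiv.Perm (Fin 4) := ⟨![1,0,3,2], ![1,0,3,2], by decide, by decide⟩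

open Finset

/-- `π` contains no occurrence of 132. -/
def NoOneThreeTwo {n : ℕ} (π : Equiv.Perm (Fin n)) : Prop :=
  ∀ i j l : Fin n, i < j → j < l → ¬ (π i < π l ∧ π l < π j)

/-- `π` contains no occurrence of 213. -/
def NoTwoOneThree {n : ℕ} (π : Equiv.Perm (Fin n)) : Prop :=
  ∀ i j l : Fin n, i < j → j < l → ¬ (π j < π i ∧ π i < π l)

/-- The Lehmer code of `π`. -/
def lehmer {n : ℕ} (π : Equiv.Perm (Fin n)) (i : Fin n) : ℕ :=
  #{j | i < j ∧ π j < π i}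

lemma contains_of_four {n : ℕ} {π : Equiv.Perm (Fin n)} {p : Equiv.Perm (Fin 4)}
    (a b c d : Fin n) (hab : a < b) (hbc : b < c) (hcd : c < d)
    (h : ∀ x y : Fin 4, π (![a, b, c, d] x) < π (![a, b, c, d] y) ↔ p x < p y) :
    Contains π p := by
  refine ⟨![a, b, c, d], ?_, h⟩
  rw [Fin.strictMono_iff_lt_succ]
  intro i
  fin_cases i <;> simpa

lemma contains_1324 {n : ℕ} {π : Equiv.Perm (Fin n)} {a b c d : Fin n}
    (hab : a < b) (hbc : b < c) (hcd : c < d)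
    (h₁ : π a < π c) (h₂ : π c < π b) (h₃ : π b < π d) : Contains π p1324 := by
  refine contains_of_four a b c d hab hbc hcd fun x y => ?_
  fin_cases x <;> fin_cases y <;> simp [p1324] <;> order

lemma contains_2143 {n : ℕ} {π : Equiv.Perm (Fin n)} {a b c d : Fin n}
    (hab : a < b) (hbc : b < c) (hcd : c < d)
    (h₁ : π b < π a) (h₂ : π a < π d) (h₃ : π d < π c) : Contains π p2143 := by
  refine contains_of_four a b c d hab hbc hcd fun x y => ?_
  fin_cases x <;> fin_cases y <;> simp [p2143] <;> order

lemma NoOneThreeTwo.avoids {n : ℕ} {π : Equiv.Perm (Fin n)} (h : NoOneThreeTwo π) :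
    Avoids π p1324 ∧ Avoids π p2143 := by
  constructor
  · rintro ⟨f, hf, hp⟩
    exact h (f 0) (f 1) (f 2) (hf (by decide)) (hf (by decide))
      ⟨(hp _ _).2 (by decide), (hp _ _).2 (by decide)⟩
  · rintro ⟨f, hf, hp⟩
    exact h (f 1) (f 2) (f 3) (hf (by decide)) (hf (by decide))
      ⟨(hp _ _).2 (by decide), (hp _ _).2 (by decide)⟩

lemma NoTwoOneThree.avoids {n : ℕ} {π : Equiv.Perm (Fin n)} (h : NoTwoOneThree π) :
    Avoids π p1324 ∧ Avoids π p2143 := by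
  constructor
  · rintro ⟨f, hf, hp⟩
    exact h (f 1) (f 2) (f 3) (hf (by decide)) (hf (by decide))
      ⟨(hp _ _).2 (by decide), (hp _ _).2 (by decide)⟩
  · rintro ⟨f, hf, hp⟩
    exact h (f 0) (f 1) (f 2) (hf (by decide)) (hf (by decide))
      ⟨(hp _ _).2 (by decide), (hp _ _).2 (by decide)⟩

/-- A permutation with fewer than `n - 1` inversions is a direct sum of two nonempty ones. -/
lemma exists_cut {n : ℕ} (π : Equiv.Perm (Fin n)) (h : invCount π + 1 < n) :
    ∃ c : Fin n, 0 < c.val ∧ ∀ a b, a < c → c ≤ b → π a < π b := by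
  by_contra! hcut
  have key : ∀ j : {j : Fin n // 0 < j.val}, ∃ q : Fin n × Fin n,
      q.1 < j.1 ∧ j.1 ≤ q.2 ∧ π q.2 < π q.1 ∧ (∀ a < j.1, π a ≤ π q.1) ∧
        (π j.1 < π q.1 → q.2 = j.1) := by
    rintro ⟨j, hj⟩
    obtain ⟨a, b, ha, hb, hab⟩ := hcut j hj
    obtain ⟨p, hp, hmax⟩ := exists_max_image (Finset.Iio j) π ⟨a, by simpa using ha⟩
    simp only [Finset.mem_Iio] at hp hmax
    by_cases hjp : π j < π p
    · exact ⟨(p, j), hp, le_rfl, hjp, hmax, fun _ => rfl⟩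
    · have hne : b ≠ a := (ha.trans_le hb).ne'
      have : π b ≠ π a := fun e => hne (π.injective e)
      exact ⟨(p, b), hp, hb, (lt_of_le_of_ne hab this).trans_le (hmax a ha), hmax,
        fun h => absurd h hjp⟩
  choose f hf₁ hf₂ hf₃ hf₄ hf₅ using key
  have hlt : ∀ j j', f j = f j' → ¬ j.1 < j'.1 := by
    intro j j' e hjj
    have h₁ : π j.1 ≤ π (f j).1 := e ▸ hf₄ j' j.1 hjj
    have h₂ : π j.1 ≠ π (f j).1 := fun e' => (hf₁ j).ne' (π.injective e')
    have h₃ := hf₅ j (lt_of_le_of_ne h₁ h₂)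
    have h₄ := hf₂ j'
    rw [← e, h₃] at h₄
    exact absurd hjj h₄.not_gt
  let g : {j : Fin n // 0 < j.val} → {ij : Fin n × Fin n // ij.1 < ij.2 ∧ π ij.2 < π ij.1} :=
    fun j => ⟨f j, (hf₁ j).trans_le (hf₂ j), hf₃ j⟩
  have hg : Function.Injective g := fun j j' e => by
    have e' : f j = f j' := congrArg Subtype.val e
    exact Subtype.ext (le_antisymm (not_lt.1 (hlt _ _ e'.symm)) (not_lt.1 (hlt _ _ e')))
  have hcard := Nat.card_le_card_of_injective g hg
  have : Nat.card {j : Fin n // 0 < j.val} = n - 1 := by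
    obtain ⟨m, rfl⟩ : ∃ m, n = m + 1 := ⟨n - 1, by omega⟩
    have : ∀ j : Fin (m + 1), 0 < j.val ↔ j ≠ 0 := fun j => by
      rw [Nat.pos_iff_ne_zero, Ne, Ne, Fin.ext_iff]; rfl
    simp [this]
  rw [this] at hcard
  unfold invCount at h
  omega

lemma noOneThreeTwo_or_noTwoOneThree {n : ℕ} {π : Equiv.Perm (Fin n)} (h : invCount π + 1 < n)
    (h₁ : Avoids π p1324) (h₂ : Avoids π p2143) : NoOneThreeTwo π ∨ NoTwoOneThree π := by
  obtain ⟨c, hc, hcut⟩ := exists_cut π h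
  by_contra! hcon
  simp only [NoOneThreeTwo, NoTwoOneThree] at hcon
  push Not at hcon
  obtain ⟨⟨i, j, l, hij, hjl, hil, hlj⟩, i', j', l', hij', hjl', hji', hil'⟩ := hcon
  have hl : ¬ l < c := fun hl => by
    let z : Fin n := ⟨n - 1, by omega⟩
    have hz : c ≤ z := Fin.le_def.2 (by simp [z]; omega)
    exact h₁ (contains_1324 hij hjl (hl.trans_le hz) hil hlj (hcut _ _ (hjl.trans hl) hz))
  have hj : c ≤ j := by
    by_contra! hj
    exact (hcut j l hj (not_lt.1 hl)).not_gt hlj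
  have hi' : i' < c := by
    by_contra! hi
    let z : Fin n := ⟨0, by omega⟩
    have hz : z < c := Fin.lt_def.2 hc
    exact h₁ (contains_1324 (hz.trans_le hi) hij' hjl' (hcut _ _ hz (hi.trans hij'.le)) hji' hil')
  have hj' : j' < c := by
    by_contra! hj
    exact (hcut i' j' hi' hj).not_gt hji'
  exact h₂ (contains_2143 hij' (hj'.trans_le hj) hjl hji' (hcut _ _ hi' (not_lt.1 hl)) hlj)

lemma NoOneThreeTwo.not_noTwoOneThree {n : ℕ} {π : Equiv.Perm (Fin n)} (h : invCount π + 1 < n)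
    (h₀ : invCount π ≠ 0) (h₁ : NoOneThreeTwo π) : ¬ NoTwoOneThree π := by
  intro h₂
  obtain ⟨c, hc, hcut⟩ := exists_cut π h
  obtain ⟨⟨⟨i, j⟩, hij, hji⟩⟩ := (Nat.card_ne_zero.1 h₀).1
  simp only at hij hji
  by_cases hi : i < c
  · have hj : j < c := by
      by_contra! hj
      exact (hcut i j hi hj).not_gt hji
    let z : Fin n := ⟨n - 1, by omega⟩
    have hz : c ≤ z := Fin.le_def.2 (by simp [z]; omega)
    exact h₂ i j z hij (hj.trans_le hz) ⟨hji, hcut _ _ hi hz⟩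
  · let z : Fin n := ⟨0, by omega⟩
    have hz : z < c := Fin.lt_def.2 hc
    have hi := not_lt.1 hi
    exact h₁ z i j (hz.trans_le hi) hij ⟨hcut _ _ hz (hi.trans hij.le), hji⟩

/-- Reverse-complement of permutations. -/
def reverseComplement (n : ℕ) : Equiv.Perm (Fin n) ≃ Equiv.Perm (Fin n) :=
  Fin.revPerm.permCongr

lemma reverseComplement_apply {n : ℕ} (π : Equiv.Perm (Fin n)) (i : Fin n) :
    reverseComplement n π i = (π i.rev).rev := by
  simp [reverseComplement]

lemma invCount_reverseComplement {n : ℕ} (π : Equiv.Perm (Fin n)) :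
    invCount (reverseComplement n π) = invCount π := by
  refine Nat.card_congr
    (((Equiv.prodComm _ _).trans (Fin.revPerm.prodCongr Fin.revPerm)).subtypeEquiv ?_)
  rintro ⟨i, j⟩
  simp [reverseComplement_apply]

lemma noTwoOneThree_iff_reverseComplement {n : ℕ} (π : Equiv.Perm (Fin n)) :
    NoTwoOneThree π ↔ NoOneThreeTwo (reverseComplement n π) := by
  simp only [NoTwoOneThree, NoOneThreeTwo, reverseComplement_apply, Fin.rev_lt_rev]
  constructor
  · intro h i j l hij hjl ⟨h₁, h₂⟩
    exact h l.rev j.rev i.rev (Fin.rev_lt_rev.2 hjl) (Fin.rev_lt_rev.2 hij) ⟨h₂, h₁⟩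
  · intro h i j l hij hjl ⟨h₁, h₂⟩
    exact h l.rev j.rev i.rev (Fin.rev_lt_rev.2 hjl) (Fin.rev_lt_rev.2 hij) (by simpa using ⟨h₂, h₁⟩)

lemma sum_lehmer {n : ℕ} (π : Equiv.Perm (Fin n)) : ∑ i, lehmer π i = invCount π := by
  classical
  rw [invCount, Nat.card_eq_fintype_card, Fintype.card_subtype, ← Finset.univ_product_univ,
    Finset.card_filter, Finset.sum_product]
  simp only [lehmer, Finset.card_filter]

lemma noOneThreeTwo_iff_antitone_lehmer {n : ℕ} (π : Equiv.Perm (Fin n)) :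
    NoOneThreeTwo π ↔ Antitone (lehmer π) := by
  constructor
  · intro h i j hij
    rcases hij.eq_or_lt with rfl | hij
    · exact le_rfl
    refine card_le_card fun l hl => ?_
    simp only [mem_filter, mem_univ, true_and] at hl ⊢
    refine ⟨hij.trans hl.1, ?_⟩
    by_contra! hle
    have hne : π i ≠ π l := fun e => (hij.trans hl.1).ne (π.injective e)
    exact h i j l hij hl.1 ⟨lt_of_le_of_ne hle hne, hl.2⟩
  · intro h i j l hij hjl ⟨h₁, h₂⟩
    obtain ⟨m, hm, hmax⟩ := exists_max_image ({a | a < j ∧ π a < π l} : Finset (Fin n)) id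
      ⟨i, by simp [hij, h₁]⟩
    simp only [mem_filter, mem_univ, true_and, id] at hm hmax
    have hlt : lehmer π m < lehmer π j := by
      refine card_lt_card (ssubset_of_subset_of_ne (fun a ha => ?_) fun e => ?_)
      · simp only [mem_filter, mem_univ, true_and] at ha ⊢
        have hal : π a < π l := ha.2.trans hm.2
        refine ⟨?_, hal.trans h₂⟩
        by_contra! haj
        rcases haj.eq_or_lt with rfl | haj
        · exact hal.not_gt h₂
        · exact (hmax a ⟨haj, hal⟩).not_gt ha.1
      · have : l ∈ ({a | j < a ∧ π a < π j} : Finset (Fin n)) := by simp [hjl, h₂]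
        rw [← e] at this
        simp only [mem_filter, mem_univ, true_and] at this
        exact this.2.not_gt hm.2
    exact (h hm.1.le).not_gt hlt

lemma lehmer_lt_of_first_difference {n : ℕ} {π σ : Equiv.Perm (Fin n)} {i : Fin n}
    (heq : ∀ j < i, π j = σ j) (hlt : π i < σ i) : lehmer π i < lehmer σ i := by
  have hmem : ∀ j, i ≤ j → π j < σ i → i < σ.symm (π j) := by
    intro j hij hj
    by_contra! hle
    rcases hle.eq_or_lt with e | hlt'
    · rw [← e, σ.apply_symm_apply] at hj
      exact lt_irrefl _ hj
    · have e := heq _ hlt'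
      rw [σ.apply_symm_apply] at e
      rw [π.injective e] at hlt'
      exact hlt'.not_ge hij
  have hinj : Function.Injective fun j => σ.symm (π j) := σ.symm.injective.comp π.injective
  rw [lehmer, ← card_image_of_injective _ hinj]
  refine card_lt_card (ssubset_of_subset_of_ne (fun a ha => ?_) fun e => ?_)
  · simp only [mem_image, mem_filter, mem_univ, true_and] at ha ⊢
    obtain ⟨j, ⟨hij, hj⟩, rfl⟩ := ha
    exact ⟨hmem j hij.le (hj.trans hlt), by simpa using hj.trans hlt⟩
  · have : σ.symm (π i) ∈ ({a | i < a ∧ σ a < σ i} : Finset (Fin n)) := by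
      simp [hmem i le_rfl hlt, hlt]
    rw [← e] at this
    simp at this

lemma lehmer_injective {n : ℕ} : Function.Injective (lehmer (n := n)) := by
  intro π σ h
  by_contra hne
  obtain ⟨a, ha⟩ : ∃ a, π a ≠ σ a := by
    by_contra! hall
    exact hne (Equiv.ext hall)
  obtain ⟨i, hi, hmin⟩ := exists_min_image ({a | π a ≠ σ a} : Finset (Fin n)) id ⟨a, by simpa⟩
  simp only [mem_filter, mem_univ, true_and, id] at hi hmin
  have heq : ∀ j < i, π j = σ j := fun j hj => by
    by_contra hj'
    exact (hmin j hj').not_gt hj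
  rcases lt_or_gt_of_ne hi with hlt | hlt
  · exact (lehmer_lt_of_first_difference heq hlt).ne (congrFun h i)
  · exact (lehmer_lt_of_first_difference (fun j hj => (heq j hj).symm) hlt).ne' (congrFun h i)

lemma lehmer_lt {n : ℕ} (π : Equiv.Perm (Fin n)) (i : Fin n) : lehmer π i < n - i := by
  have : lehmer π i ≤ #(Finset.Ioi i) := card_le_card fun j hj => by
    simp only [mem_filter, mem_univ, true_and] at hj
    simpa using hj.1
  rw [Fin.card_Ioi] at this
  omega

lemma exists_lehmer_eq {n : ℕ} (c : Fin n → ℕ) (hc : ∀ i, c i < n - i) :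
    ∃ π : Equiv.Perm (Fin n), lehmer π = c := by
  let F : Equiv.Perm (Fin n) → ∀ i : Fin n, Fin (n - i) := fun π i => ⟨lehmer π i, lehmer_lt π i⟩
  have hinj : Function.Injective F := fun π σ h =>
    lehmer_injective (funext fun i => congrArg Fin.val (congrFun h i))
  have hcard : Fintype.card (Equiv.Perm (Fin n)) = Fintype.card (∀ i : Fin n, Fin (n - i)) := by
    rw [Fintype.card_perm, Fintype.card_fin, Fintype.card_pi]
    simp only [Fintype.card_fin]
    rw [Fin.prod_univ_eq_prod_range (fun i => n - i) n, ← Nat.descFactorial_eq_prod_range,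
      Nat.descFactorial_self]
  obtain ⟨π, hπ⟩ := ((Fintype.bijective_iff_injective_and_card F).2 ⟨hinj, hcard⟩).2
    fun i => ⟨c i, hc i⟩
  exact ⟨π, funext fun i => congrArg Fin.val (congrFun hπ i)⟩

lemma lt_sub_of_antitone {n : ℕ} {c : Fin n → ℕ} (hc : Antitone c) (hsum : ∑ i, c i < n)
    (i : Fin n) : c i < n - i := by
  rcases Nat.eq_zero_or_pos (c i) with h | h
  · omega
  have h₁ : #(Finset.Iic i) • c i ≤ ∑ j ∈ Finset.Iic i, c j :=
    card_nsmul_le_sum _ _ _ fun j hj => hc (by simpa using hj)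
  have h₂ : ∑ j ∈ Finset.Iic i, c j ≤ ∑ j, c j := sum_le_sum_of_subset (subset_univ _)
  rw [Fin.card_Iic, smul_eq_mul] at h₁
  have h₃ : i + c i ≤ (i + 1) * c i := by nlinarith
  omega

lemma eq_of_antitone_of_map_eq {n : ℕ} {c d : Fin n → ℕ} (hc : Antitone c) (hd : Antitone d)
    (h : univ.val.map c = univ.val.map d) : c = d := by
  rw [Fin.univ_val_map, Fin.univ_val_map, Multiset.coe_eq_coe] at h
  exact List.ofFn_injective (h.eq_of_pairwise' hc.sortedGE_ofFn.pairwise hd.sortedGE_ofFn.pairwise)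

lemma Multiset.eq_of_filter_ne_zero_eq {s t : Multiset ℕ} (hcard : s.card = t.card)
    (h : s.filter (· ≠ 0) = t.filter (· ≠ 0)) : s = t := by
  have key : ∀ u : Multiset ℕ,
      u = u.filter (· ≠ 0) + Multiset.replicate (u.card - (u.filter (· ≠ 0)).card) 0 := by
    intro u
    have e := Multiset.filter_add_not (· ≠ 0) u
    have e' : u.filter (fun a => ¬ a ≠ 0) =
        Multiset.replicate (u.card - (u.filter (· ≠ 0)).card) 0 := by
      rw [Multiset.eq_replicate]
      refine ⟨?_, fun b hb => by simpa using (Multiset.mem_filter.1 hb).2⟩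
      have := congrArg Multiset.card e
      rw [Multiset.card_add] at this
      omega
    rw [← e', e]
  rw [key s, key t, hcard, h]

lemma exists_antitone_map_eq {n : ℕ} (s : Multiset ℕ) (hs : s.card = n) :
    ∃ c : Fin n → ℕ, Antitone c ∧ univ.val.map c = s := by
  subst hs
  have hlen : (s.sort (· ≥ ·)).length = s.card := s.length_sort _
  refine ⟨fun i => (s.sort (· ≥ ·)).get (i.cast hlen.symm), ?_, ?_⟩
  · intro i j hij
    exact (s.pairwise_sort (· ≥ ·)).sortedGE.antitone_get (by simpa using hij)
  · rw [Fin.univ_val_map]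
    conv_rhs => rw [← s.sort_eq (· ≥ ·)]
    congr 1
    apply List.ext_get <;> simp

lemma card_noOneThreeTwo {n k : ℕ} (hn : k < n) :
    Nat.card {π : Equiv.Perm (Fin n) // invCount π = k ∧ NoOneThreeTwo π} =
      Nat.card (Nat.Partition k) := by
  let F : {π : Equiv.Perm (Fin n) // invCount π = k ∧ NoOneThreeTwo π} → Nat.Partition k :=
    fun π => Nat.Partition.ofSums k (univ.val.map (lehmer π.1)) ((sum_lehmer π.1).trans π.2.1)
  refine Nat.card_eq_of_bijective F ⟨fun π σ h => ?_, fun P => ?_⟩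
  · have h' := congrArg Nat.Partition.parts h
    refine Subtype.ext (lehmer_injective (eq_of_antitone_of_map_eq
      ((noOneThreeTwo_iff_antitone_lehmer _).1 π.2.2)
      ((noOneThreeTwo_iff_antitone_lehmer _).1 σ.2.2)
      (Multiset.eq_of_filter_ne_zero_eq (by simp) h')))
  · have hcard : P.parts.card ≤ k := by
      have := Multiset.card_nsmul_le_sum (s := P.parts) (a := 1) fun x hx => P.parts_pos hx
      simpa [P.parts_sum] using this
    obtain ⟨c, hc, hmap⟩ := exists_antitone_map_eq (n := n)
      (P.parts + Multiset.replicate (n - P.parts.card) 0) (by simp; omega)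
    have hsum : ∑ i, c i = k := by
      rw [Finset.sum, hmap]
      simp [P.parts_sum]
    obtain ⟨π, hπ⟩ := exists_lehmer_eq c (lt_sub_of_antitone hc (hsum.trans_lt hn))
    refine ⟨⟨π, by rw [← sum_lehmer, hπ, hsum],
      (noOneThreeTwo_iff_antitone_lehmer _).2 (hπ ▸ hc)⟩, Nat.Partition.ext ?_⟩
    change (univ.val.map (lehmer π)).filter (· ≠ 0) = P.parts
    rw [hπ, hmap, Multiset.filter_add, Multiset.filter_eq_self.2 fun x hx => (P.parts_pos hx).ne',
      Multiset.filter_eq_nil.2 fun x hx => by simp [Multiset.eq_of_mem_replicate hx], add_zero]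

/-- For every `k ≥ 1` and every `n ≥ k + 2`, the number of permutations of length `n`
with exactly `k` inversions avoiding both 1324 and 2143 equals `2·p(k)`, where `p(k)`
is the number of integer partitions of `k`. -/
theorem av_1324_2143_eq (k n : ℕ) (hk : 1 ≤ k) (hn : k + 2 ≤ n) :
    Nat.card {π : Equiv.Perm (Fin n) // invCount π = k ∧
      Avoids π p1324 ∧ Avoids π p2143} = 2 * Nat.card (Nat.Partition k) := by
  classical
  have hiff : ∀ π : Equiv.Perm (Fin n), (invCount π = k ∧ Avoids π p1324 ∧ Avoids π p2143) ↔
      (invCount π = k ∧ NoOneThreeTwo π) ∨ (invCount π = k ∧ NoTwoOneThree π) := by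
    intro π
    rw [← and_or_left]
    refine and_congr_right fun h => ⟨fun ⟨h₁, h₂⟩ => ?_, ?_⟩
    · exact noOneThreeTwo_or_noTwoOneThree (by omega) h₁ h₂
    · rintro (h | h) <;> exact h.avoids
  have hdisj : Disjoint (fun π : Equiv.Perm (Fin n) => invCount π = k ∧ NoOneThreeTwo π)
      (fun π => invCount π = k ∧ NoTwoOneThree π) := by
    rw [Pi.disjoint_iff]
    intro π
    rw [Prop.disjoint_iff]
    rintro ⟨⟨h, h₁⟩, -, h₂⟩
    exact h₁.not_noTwoOneThree (by omega) (by omega) h₂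
  have hsymm : Nat.card {π : Equiv.Perm (Fin n) // invCount π = k ∧ NoTwoOneThree π} =
      Nat.card {π : Equiv.Perm (Fin n) // invCount π = k ∧ NoOneThreeTwo π} :=
    Nat.card_congr ((reverseComplement n).subtypeEquiv fun π => by
      rw [invCount_reverseComplement, noTwoOneThree_iff_reverseComplement])
  rw [Nat.card_congr (Equiv.subtypeEquivRight hiff), Nat.card_congr (subtypeOrEquiv _ _ hdisj),
    Nat.card_sum, hsymm, card_noOneThreeTwo (by omega), two_mul]
end

section
/- For every k ≥ 0 and every n ≥ k + 2, the number of permutations of length n with exactly k inversions that avoid both 1324 and 2413 equals the number of permutations of length n with exactly k inversions that avoid 1324 alone, and both equal Σ_{i=0}^{k} p(i)·p(k−i), where p(j) is the number of integer partitions of j. -/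
def p2413 : Equiv.Perm (Fin 4) := ⟨![1,3,0,2], ![2,0,3,1], by decide, by decide⟩

open Finset Equiv

section

variable {n : ℕ}

/-- Value-wise avoidance of the pattern 132. -/
def Avoids132 (π : Perm (Fin n)) : Prop :=
  ∀ x y z, x < y → y < z → π x < π z → π z < π y → False

/-- Value-wise avoidance of the pattern 213. -/
def Avoids213 (π : Perm (Fin n)) : Prop :=
  ∀ x y z, x < y → y < z → π y < π x → π x < π z → False

lemma avoids_p1324_iff (π : Perm (Fin n)) :
    Avoids π p1324 ↔ ∀ a b c d, a < b → b < c → c < d →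
      π a < π c → π c < π b → π b < π d → False := by
  constructor
  · intro h a b c d hab hbc hcd h1 h2 h3
    refine h ⟨![a, b, c, d], ?_, ?_⟩
    · rw [Fin.strictMono_iff_lt_succ]
      intro i
      fin_cases i <;> simpa
    · intro i j
      fin_cases i <;> fin_cases j <;> simp [p1324] <;> order
  · rintro h ⟨f, hf, hp⟩
    refine h (f 0) (f 1) (f 2) (f 3) (hf (by decide)) (hf (by decide)) (hf (by decide)) ?_ ?_ ?_ <;>
      rw [hp] <;> decide

lemma avoids_p2413_of_forall {π : Perm (Fin n)}
    (h : ∀ a b c d, a < b → b < c → c < d → π c < π a → π a < π d → π d < π b → False) :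
    Avoids π p2413 := by
  rintro ⟨f, hf, hp⟩
  refine h (f 0) (f 1) (f 2) (f 3) (hf (by decide)) (hf (by decide)) (hf (by decide)) ?_ ?_ ?_ <;>
    rw [hp] <;> decide

/-- The set of inversions of a permutation. -/
def inversions (π : Perm (Fin n)) : Finset (Fin n × Fin n) :=
  {ij | ij.1 < ij.2 ∧ π ij.2 < π ij.1}

lemma mem_inversions {π : Perm (Fin n)} {x y : Fin n} :
    (x, y) ∈ inversions π ↔ x < y ∧ π y < π x := by
  simp [inversions]

lemma invCount_eq_card_inversions (π : Perm (Fin n)) : invCount π = #(inversions π) := by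
  rw [invCount, Nat.card_eq_fintype_card, Fintype.card_subtype, inversions]

/-- The Lehmer code of a permutation. -/
def lehmerCode (π : Perm (Fin n)) (x : Fin n) : ℕ := #{y | x < y ∧ π y < π x}

lemma invCount_eq_sum_lehmerCode (π : Perm (Fin n)) : invCount π = ∑ x, lehmerCode π x := by
  rw [invCount_eq_card_inversions, card_eq_sum_card_fiberwise (f := Prod.fst) (t := univ) (by simp)]
  refine sum_congr rfl fun x _ => ?_
  refine card_nbij' Prod.snd (fun y => (x, y)) ?_ ?_ ?_ ?_
  · rintro ⟨a, b⟩ h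
    simp only [mem_inversions, coe_filter, Set.mem_ofPred_eq, mem_univ, true_and] at h ⊢
    obtain ⟨h, rfl⟩ := h
    exact h
  · intro b h
    simpa [mem_inversions] using h
  · rintro ⟨a, b⟩ h
    simp only [coe_filter, Set.mem_ofPred_eq] at h
    simp [h.2]
  · intro b h
    rfl

lemma lehmerCode_add_lt (π : Perm (Fin n)) (x : Fin n) : lehmerCode π x + x < n := by
  have h : lehmerCode π x ≤ #(Ioi x) := card_le_card fun y hy => by
    simp only [mem_filter] at hy
    exact mem_Ioi.2 hy.2.1
  rw [Fin.card_Ioi] at h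
  omega

lemma sub_le_lehmerCode (π : Perm (Fin n)) (x : Fin n) :
    (π x : ℕ) - x ≤ lehmerCode π x := by
  have h : (Iio (π x)).map π.symm.toEmbedding ⊆
      Iio x ∪ univ.filter fun y => x < y ∧ π y < π x := by
    intro y hy
    have hy' : π y < π x := by simpa [Equiv.symm_apply_eq] using hy
    rcases lt_trichotomy y x with h | rfl | h
    · simp [h]
    · exact absurd hy' (lt_irrefl _)
    · simp [h, hy']
  have h1 := (card_le_card h).trans (card_union_le _ _)
  rw [card_map, Fin.card_Iio, Fin.card_Iio] at h1
  exact Nat.sub_le_iff_le_add'.2 h1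

lemma eq_of_lehmerCode_eq {π ρ : Perm (Fin n)} (h : lehmerCode π = lehmerCode ρ) : π = ρ := by
  have key : ∀ {π ρ : Perm (Fin n)} (x : Fin n), (∀ y < x, π y = ρ y) → π x < ρ x →
      lehmerCode π x < lehmerCode ρ x := by
    intro π ρ x hlt hx
    have image : ∀ τ : Perm (Fin n), lehmerCode τ x = #{v | x < τ.symm v ∧ v < τ x} := by
      intro τ
      refine card_nbij' τ τ.symm ?_ ?_ ?_ ?_ <;> intro y <;> simp
    have back : ∀ v, x ≤ π.symm v → x ≤ ρ.symm v := by
      intro v hv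
      by_contra! hcon
      have := hlt _ hcon
      rw [apply_symm_apply, ← Equiv.eq_symm_apply] at this
      order
    rw [image, image]
    refine card_lt_card (ssubset_iff_of_subset ?_ |>.2 ⟨π x, ?_, by simp⟩)
    · intro v
      simp only [mem_filter, mem_univ, true_and]
      rintro ⟨h1, h2⟩
      refine ⟨lt_of_le_of_ne (back v h1.le) ?_, h2.trans hx⟩
      rintro rfl
      rw [apply_symm_apply] at hx
      order
    · simp only [mem_filter, mem_univ, true_and]
      refine ⟨lt_of_le_of_ne (back _ (by simp)) ?_, hx⟩
      intro heq
      rw [Equiv.eq_symm_apply] at heq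
      order
  ext x
  congr 1
  induction x using WellFoundedLT.induction with
  | _ x ih =>
    rcases lt_trichotomy (π x) (ρ x) with hx | hx | hx
    · exact absurd (congrFun h x) (key x ih hx).ne
    · exact hx
    · exact absurd (congrFun h x) (key x (fun y hy => (ih y hy).symm) hx).ne'

lemma exists_lehmerCode_eq {f : Fin n → ℕ} (hf : ∀ x, f x + x < n) :
    ∃ π : Perm (Fin n), lehmerCode π = f := by
  let F : Perm (Fin n) → ((x : Fin n) → Fin (n - x)) := fun π x =>
    ⟨lehmerCode π x, Nat.lt_sub_of_add_lt (lehmerCode_add_lt π x)⟩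
  have hF : Function.Injective F := fun π ρ h =>
    eq_of_lehmerCode_eq (funext fun x => congrArg Fin.val (congrFun h x))
  have hcard : Fintype.card (Perm (Fin n)) = Fintype.card ((x : Fin n) → Fin (n - x)) := by
    rw [Fintype.card_perm, Fintype.card_pi, Fintype.card_fin, ← Nat.descFactorial_self,
      Nat.descFactorial_eq_prod_range, ← Fin.prod_univ_eq_prod_range (fun i => n - i)]
    simp
  obtain ⟨π, hπ⟩ := ((Fintype.bijective_iff_injective_and_card F).2 ⟨hF, hcard⟩).2
    fun x => ⟨f x, Nat.lt_sub_of_add_lt (hf x)⟩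
  exact ⟨π, funext fun x => congrArg Fin.val (congrFun hπ x)⟩

lemma avoids132_iff_antitone_lehmerCode (π : Perm (Fin n)) :
    Avoids132 π ↔ Antitone (lehmerCode π) := by
  constructor
  · intro h x y hxy
    rcases hxy.eq_or_lt with rfl | hxy
    · rfl
    refine card_le_card fun z => ?_
    simp only [mem_filter, mem_univ, true_and]
    rintro ⟨hyz, hz⟩
    refine ⟨hxy.trans hyz, ?_⟩
    by_contra! hcon
    refine h x y z hxy hyz (lt_of_le_of_ne hcon fun heq => ?_) hz
    have := π.injective heq
    order
  · intro h x y z hxy hyz h1 h2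
    induction hx : n - x using Nat.strong_induction_on generalizing x with
    | _ d ih =>
      by_cases hw : ∃ w, x < w ∧ w < y ∧ π w < π x
      · obtain ⟨w, hxw, hwy, hw⟩ := hw
        exact ih (n - w) (by omega) w hwy (hw.trans h1) rfl
      · push Not at hw
        refine absurd (h hxy.le) (not_le.2 (card_lt_card ?_))
        refine ssubset_iff_of_subset ?_ |>.2 ⟨z, by simp [hyz, h2], by simp [h1.le]⟩
        intro w
        simp only [mem_filter, mem_univ, true_and]
        rintro ⟨hxw, hwx⟩
        refine ⟨?_, by order⟩
        by_contra! hcon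
        rcases hcon.eq_or_lt with rfl | hcon
        · order
        · exact absurd (hw w hxw hcon) (not_le.2 hwx)

lemma exists_antitone_map_eq_s11 {M : Multiset ℕ} (hM : M.card = n) :
    ∃ f : Fin n → ℕ, Antitone f ∧ univ.val.map f = M := by
  obtain ⟨l, hl, rfl⟩ : ∃ l : List ℕ, l.Pairwise (· ≥ ·) ∧ (l : Multiset ℕ) = M :=
    ⟨M.sort (· ≥ ·), M.pairwise_sort _, M.sort_eq _⟩
  obtain rfl : l.length = n := hM
  exact ⟨l.get, hl.sortedGE.antitone_get, by simp [-List.get_eq_getElem]⟩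

lemma eq_of_antitone_of_map_eq_s11 {f g : Fin n → ℕ} (hf : Antitone f) (hg : Antitone g)
    (h : univ.val.map f = univ.val.map g) : f = g := by
  rw [Fin.univ_val_map, Fin.univ_val_map, Multiset.coe_eq_coe] at h
  exact List.ofFn_injective (h.eq_of_sortedGE hf.sortedGE_ofFn hg.sortedGE_ofFn)

lemma multiset_eq_of_filter_ne_zero_eq {M N : Multiset ℕ} (hcard : M.card = N.card)
    (h : M.filter (· ≠ 0) = N.filter (· ≠ 0)) : M = N := by
  have split : ∀ K : Multiset ℕ, K = Multiset.replicate (K.count 0) 0 + K.filter (· ≠ 0) := by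
    intro K
    conv_lhs => rw [← Multiset.filter_add_not (· = 0) K]
    rw [Multiset.filter_eq']
  have hM := congrArg Multiset.card (split M)
  have hN := congrArg Multiset.card (split N)
  rw [Multiset.card_add, Multiset.card_replicate] at hM hN
  rw [split M, split N, h]
  rw [h] at hM
  congr 2
  omega

lemma add_lt_of_antitone_of_sum_lt {f : Fin n → ℕ} (hf : Antitone f) (hsum : ∑ x, f x < n)
    (x : Fin n) : f x + x < n := by
  rcases Nat.eq_zero_or_pos (f x) with h0 | hpos
  · omega
  have h1 : (x + 1) * f x ≤ ∑ y, f y := calc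
    (x + 1) * f x = ∑ y ∈ Iic x, f x := by simp
    _ ≤ ∑ y ∈ Iic x, f y := sum_le_sum fun y hy => hf (mem_Iic.1 hy)
    _ ≤ ∑ y, f y := sum_le_sum_of_subset (subset_univ _)
  nlinarith

lemma card_avoids132_eq_card_partition {i : ℕ} (hi : i < n) :
    Nat.card {σ : Perm (Fin n) // Avoids132 σ ∧ invCount σ = i} = Nat.card (Nat.Partition i) := by
  refine Nat.card_eq_of_bijective (fun σ => Nat.Partition.ofSums i
    (univ.val.map (lehmerCode σ.1)) ((invCount_eq_sum_lehmerCode σ.1).symm.trans σ.2.2)) ⟨?_, ?_⟩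
  · rintro ⟨σ, hσ, hσi⟩ ⟨τ, hτ, hτi⟩ h
    rw [avoids132_iff_antitone_lehmerCode] at hσ hτ
    exact Subtype.ext (eq_of_lehmerCode_eq (eq_of_antitone_of_map_eq_s11 hσ hτ
      (multiset_eq_of_filter_ne_zero_eq (by simp) (congrArg Nat.Partition.parts h))))
  · intro p
    have hp : p.parts.card ≤ i := by
      conv_rhs => rw [← p.parts_sum]
      simpa using Multiset.card_nsmul_le_sum fun x hx => p.parts_pos hx
    obtain ⟨f, hf, hmap⟩ := exists_antitone_map_eq_s11 (n := n)
      (M := p.parts + Multiset.replicate (n - p.parts.card) 0) (by simp; omega)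
    have hsum : ∑ x, f x = i := by
      rw [Finset.sum_eq_multiset_sum, hmap]
      simp [p.parts_sum]
    obtain ⟨σ, rfl⟩ := exists_lehmerCode_eq (add_lt_of_antitone_of_sum_lt hf (hsum ▸ hi))
    refine ⟨⟨σ, (avoids132_iff_antitone_lehmerCode σ).2 hf,
      (invCount_eq_sum_lehmerCode σ).trans hsum⟩, ?_⟩
    ext1
    simp only [Nat.Partition.ofSums, hmap, Multiset.filter_add]
    rw [Multiset.filter_eq_self.2 fun x hx => (p.parts_pos hx).ne',
      Multiset.filter_eq_nil.2 fun x hx => by simp [Multiset.eq_of_mem_replicate hx], add_zero]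

/-- Conjugation by the order reversal: the reverse-complement of a permutation. -/
def revConj (π : Perm (Fin n)) : Perm (Fin n) := Fin.revPerm * π * Fin.revPerm

lemma revConj_apply (π : Perm (Fin n)) (x : Fin n) : revConj π x = (π x.rev).rev := rfl

lemma revConj_involutive : Function.Involutive (revConj (n := n)) := by
  intro π
  ext x
  simp [revConj_apply]

lemma invCount_revConj (π : Perm (Fin n)) : invCount (revConj π) = invCount π := by
  rw [invCount_eq_card_inversions, invCount_eq_card_inversions]
  refine card_nbij' (fun ij => (ij.2.rev, ij.1.rev)) (fun ij => (ij.2.rev, ij.1.rev)) ?_ ?_ ?_ ?_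
  all_goals
    rintro ⟨a, b⟩
    simp [mem_inversions, revConj_apply]

lemma avoids132_revConj_iff (π : Perm (Fin n)) : Avoids132 (revConj π) ↔ Avoids213 π := by
  constructor
  · intro h x y z hxy hyz h1 h2
    refine h z.rev y.rev x.rev ?_ ?_ ?_ ?_ <;> simpa [revConj_apply]
  · intro h x y z hxy hyz h1 h2
    simp only [revConj_apply, Fin.rev_lt_rev] at h1 h2
    exact h z.rev y.rev x.rev (by simpa) (by simpa) h2 h1

lemma card_avoids213_eq_card_partition {j : ℕ} (hj : j < n) :
    Nat.card {τ : Perm (Fin n) // Avoids213 τ ∧ invCount τ = j} = Nat.card (Nat.Partition j) := by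
  rw [← card_avoids132_eq_card_partition hj]
  refine Nat.card_congr (revConj_involutive.toPerm.subtypeEquiv fun τ => ?_)
  rw [Function.Involutive.coe_toPerm, avoids132_revConj_iff, invCount_revConj]

/-- `π` maps the first `m` positions to the `m` smallest values. -/
def SplitsAt (π : Perm (Fin n)) (m : ℕ) : Prop := ∀ x : Fin n, (x : ℕ) < m → (π x : ℕ) < m

lemma SplitsAt.apply_lt_iff {π : Perm (Fin n)} {m : ℕ} (h : SplitsAt π m) (x : Fin n) :
    (π x : ℕ) < m ↔ (x : ℕ) < m := by
  refine ⟨fun hx => ?_, h x⟩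
  have hinj : Function.Injective
      fun y : {y : Fin n // (y : ℕ) < m} => (⟨π y, h y y.2⟩ : {y : Fin n // (y : ℕ) < m}) := by
    intro y z hyz
    exact Subtype.ext (π.injective (congrArg Subtype.val hyz))
  obtain ⟨y, hy⟩ := Finite.surjective_of_injective hinj ⟨π x, hx⟩
  have := π.injective (congrArg Subtype.val hy)
  exact this ▸ y.2

lemma exists_splitsAt {π : Perm (Fin n)} {m : ℕ} (h : invCount π < m) :
    ∃ l, 1 ≤ l ∧ l ≤ m ∧ SplitsAt π l := by
  by_contra! hcon
  have hsub : Icc 1 m ⊆ univ.biUnion fun x : Fin n => Ioc (x : ℕ) (π x) := by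
    intro l hl
    rw [mem_Icc] at hl
    have := hcon l hl.1 hl.2
    simp only [SplitsAt, not_forall, not_lt] at this
    obtain ⟨x, hx, hxl⟩ := this
    simp only [mem_biUnion, mem_univ, true_and, mem_Ioc]
    exact ⟨x, hx, hxl⟩
  have h1 := (card_le_card hsub).trans card_biUnion_le
  simp only [Nat.card_Icc, Nat.card_Ioc] at h1
  have h2 := sum_le_sum fun x (_ : x ∈ univ) => sub_le_lehmerCode π x
  rw [← invCount_eq_sum_lehmerCode] at h2
  omega

lemma Avoids132.apply_eq_of_splitsAt {σ : Perm (Fin n)} (hσ : Avoids132 σ) {m : ℕ} (hm : 1 ≤ m)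
    (hs : SplitsAt σ m) (x : Fin n) (hx : m ≤ x) : σ x = x := by
  induction x using WellFoundedLT.induction with
  | _ x ih =>
    have hsx := hs.apply_lt_iff x
    rcases lt_trichotomy (σ x) x with h | h | h
    · exact σ.injective (ih _ h (by omega))
    · exact h
    · exfalso
      obtain ⟨z, hz⟩ := σ.surjective x
      have hsz := hs.apply_lt_iff z
      have h0 := hs ⟨0, by omega⟩ hm
      rw [hz] at hsz
      have hxz : x < z := by
        by_contra! hcon
        rcases hcon.eq_or_lt with rfl | hcon
        · order
        · have := ih z hcon (by omega)
          order
      refine hσ ⟨0, by omega⟩ x z ?_ hxz ?_ (hz ▸ h)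
      · rw [Fin.lt_def]
        dsimp only
        omega
      · rw [hz, Fin.lt_def]
        omega

lemma Avoids132.apply_eq_of_invCount_lt {σ : Perm (Fin n)} (hσ : Avoids132 σ) (x : Fin n)
    (hx : invCount σ < x) : σ x = x := by
  obtain ⟨l, h1, h2, hs⟩ := exists_splitsAt hx
  exact hσ.apply_eq_of_splitsAt h1 hs x h2

lemma Avoids213.apply_eq_of_add_invCount_lt {τ : Perm (Fin n)} (hτ : Avoids213 τ) (x : Fin n)
    (hx : x + invCount τ + 1 < n) : τ x = x := by
  have h := ((avoids132_revConj_iff τ).2 hτ).apply_eq_of_invCount_lt x.rev (by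
    rw [invCount_revConj, Fin.val_rev]
    omega)
  simpa [revConj_apply] using h

section product

variable {σ τ : Perm (Fin n)} {m : ℕ}

lemma splitsAt_of_fixes_ge (hσ : ∀ x : Fin n, m ≤ x → σ x = x) : SplitsAt σ m := by
  intro x hx
  by_contra! h
  have := σ.injective (hσ _ h)
  rw [this] at h
  omega

lemma splitsAt_of_fixes_lt (hτ : ∀ x : Fin n, (x : ℕ) < m → τ x = x) : SplitsAt τ m :=
  fun x hx => (hτ x hx).symm ▸ hx

lemma mul_apply_of_lt (hτ : ∀ x : Fin n, (x : ℕ) < m → τ x = x)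
    (x : Fin n) (hx : (x : ℕ) < m) : (σ * τ) x = σ x := by
  rw [Perm.mul_apply, hτ x hx]

lemma mul_apply_of_ge (hσ : ∀ x : Fin n, m ≤ x → σ x = x)
    (hτ : ∀ x : Fin n, (x : ℕ) < m → τ x = x)
    (x : Fin n) (hx : m ≤ x) : (σ * τ) x = τ x := by
  have := (splitsAt_of_fixes_lt hτ).apply_lt_iff x
  exact hσ _ (by omega)

lemma splitsAt_mul (hσ : ∀ x : Fin n, m ≤ x → σ x = x)
    (hτ : ∀ x : Fin n, (x : ℕ) < m → τ x = x) : SplitsAt (σ * τ) m := fun _ hx =>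
  splitsAt_of_fixes_ge hσ _ (splitsAt_of_fixes_lt hτ _ hx)

lemma invCount_mul (hσ : ∀ x : Fin n, m ≤ x → σ x = x)
    (hτ : ∀ x : Fin n, (x : ℕ) < m → τ x = x) : invCount (σ * τ) = invCount σ + invCount τ := by
  have hcases : ∀ x y : Fin n, x < y → ((σ * τ) y < (σ * τ) x ↔ σ y < σ x ∨ τ y < τ x) ∧
      ¬(σ y < σ x ∧ τ y < τ x) := by
    intro x y hxy
    have hsx := (splitsAt_of_fixes_ge hσ).apply_lt_iff x
    have hsy := (splitsAt_of_fixes_ge hσ).apply_lt_iff y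
    have htx := (splitsAt_of_fixes_lt hτ).apply_lt_iff x
    have hty := (splitsAt_of_fixes_lt hτ).apply_lt_iff y
    rcases lt_or_ge (x : ℕ) m with hx | hx <;> rcases lt_or_ge (y : ℕ) m with hy | hy
    · rw [mul_apply_of_lt hτ x hx, mul_apply_of_lt hτ y hy, hτ x hx, hτ y hy]
      omega
    · rw [mul_apply_of_lt hτ x hx, mul_apply_of_ge hσ hτ y hy]
      omega
    · omega
    · rw [mul_apply_of_ge hσ hτ x hx, mul_apply_of_ge hσ hτ y hy, hσ x hx, hσ y hy]
      omega
  simp only [invCount_eq_card_inversions]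
  rw [← card_union_of_disjoint]
  · congr 1
    ext ⟨x, y⟩
    have := hcases x y
    simp only [mem_union, mem_inversions]
    tauto
  · rw [disjoint_left]
    rintro ⟨x, y⟩ h1 h2
    rw [mem_inversions] at h1 h2
    exact (hcases x y h1.1).2 ⟨h1.2, h2.2⟩

lemma avoids_p1324_mul (hσ : ∀ x : Fin n, m ≤ x → σ x = x)
    (hτ : ∀ x : Fin n, (x : ℕ) < m → τ x = x)
    (h132 : Avoids132 σ) (h213 : Avoids213 τ) : Avoids (σ * τ) p1324 := by
  rw [avoids_p1324_iff]
  intro a b c d hab hbc hcd h1 h2 h3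
  have hs := splitsAt_mul hσ hτ
  rcases lt_or_ge (c : ℕ) m with hc | hc
  · rw [mul_apply_of_lt hτ a (by omega), mul_apply_of_lt hτ c hc] at h1
    rw [mul_apply_of_lt hτ c hc, mul_apply_of_lt hτ b (by omega)] at h2
    exact h132 a b c hab hbc h1 h2
  · have hb := hs.apply_lt_iff b
    have hc' := hs.apply_lt_iff c
    have hb' : m ≤ b := by omega
    rw [mul_apply_of_ge hσ hτ c hc, mul_apply_of_ge hσ hτ b hb'] at h2
    rw [mul_apply_of_ge hσ hτ b hb', mul_apply_of_ge hσ hτ d (by omega)] at h3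
    exact h213 b c d hbc hcd h2 h3

end product

lemma avoids_p2413_of_splitsAt {π : Perm (Fin n)} {m : ℕ} (hm : 1 ≤ m) (hmn : m < n)
    (hs : SplitsAt π m) (h : Avoids π p1324) : Avoids π p2413 := by
  rw [avoids_p1324_iff] at h
  refine avoids_p2413_of_forall fun a b c d hab hbc hcd h1 h2 h3 => ?_
  have hiff := hs.apply_lt_iff
  rcases lt_or_ge (d : ℕ) m with hd | hd
  · have := hiff ⟨m, hmn⟩
    have := hiff b
    refine h a b d ⟨m, hmn⟩ hab (hbc.trans hcd) hd h2 h3 ?_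
    rw [Fin.lt_def]
    dsimp only at *
    omega
  · have := hiff ⟨0, by omega⟩
    have := hiff a
    have := hiff b
    have := hiff c
    have := hiff d
    refine h ⟨0, by omega⟩ a c d ?_ (hab.trans hbc) hcd ?_ h1 h2 <;> rw [Fin.lt_def] <;>
      dsimp only at * <;> omega

lemma exists_mul_eq_of_splitsAt {π : Perm (Fin n)} {m : ℕ} (hm : 1 ≤ m) (hmn : m < n)
    (hs : SplitsAt π m) (h : Avoids π p1324) :
    ∃ σ τ : Perm (Fin n), Avoids132 σ ∧ Avoids213 τ ∧ invCount σ + invCount τ = invCount π ∧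
      σ * τ = π := by
  rw [avoids_p1324_iff] at h
  have hiff := hs.apply_lt_iff
  have hiff' : ∀ x, ¬ (π x : ℕ) < m ↔ ¬ (x : ℕ) < m := fun x => not_congr (hiff x)
  let σ : Perm (Fin n) := Perm.ofSubtype (π.subtypePerm (p := fun x : Fin n => (x : ℕ) < m) hiff)
  let τ : Perm (Fin n) := Perm.ofSubtype (π.subtypePerm (p := fun x : Fin n => ¬ (x : ℕ) < m) hiff')
  have hσlt : ∀ x : Fin n, (x : ℕ) < m → σ x = π x := fun x hx =>
    Perm.ofSubtype_subtypePerm_of_mem hiff hx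
  have hσge : ∀ x : Fin n, m ≤ x → σ x = x := fun x hx =>
    Perm.ofSubtype_subtypePerm_of_not_mem hiff hx.not_gt
  have hτge : ∀ x : Fin n, m ≤ x → τ x = π x := fun x hx =>
    Perm.ofSubtype_subtypePerm_of_mem hiff' hx.not_gt
  have hτlt : ∀ x : Fin n, (x : ℕ) < m → τ x = x := fun x hx =>
    Perm.ofSubtype_subtypePerm_of_not_mem hiff' (not_not.2 hx)
  have hmul : σ * τ = π := by
    ext1 x
    rcases lt_or_ge (x : ℕ) m with hx | hx
    · rw [mul_apply_of_lt hτlt x hx, hσlt x hx]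
    · rw [mul_apply_of_ge hσge hτlt x hx, hτge x hx]
  refine ⟨σ, τ, ?_, ?_, by rw [← invCount_mul hσge hτlt, hmul], hmul⟩
  · intro x y z hxy hyz h1 h2
    have hy := (splitsAt_of_fixes_ge hσge).apply_lt_iff y
    have hz := (splitsAt_of_fixes_ge hσge).apply_lt_iff z
    have hz' : (z : ℕ) < m := by
      by_contra! hcon
      rw [hσge z hcon] at h2
      rcases lt_or_ge (y : ℕ) m with hym | hym
      · omega
      · rw [hσge y hym] at h2
        order
    rw [hσlt x (by omega), hσlt z hz'] at h1
    rw [hσlt z hz', hσlt y (by omega)] at h2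
    have := hiff ⟨m, hmn⟩
    have := hiff y
    refine h x y z ⟨m, hmn⟩ hxy hyz hz' h1 h2 ?_
    rw [Fin.lt_def]
    dsimp only at *
    omega
  · intro x y z hxy hyz h1 h2
    have hx := (splitsAt_of_fixes_lt hτlt).apply_lt_iff x
    have hy := (splitsAt_of_fixes_lt hτlt).apply_lt_iff y
    have hx' : m ≤ x := by
      by_contra! hcon
      rw [hτlt x hcon] at h1
      rcases lt_or_ge (y : ℕ) m with hym | hym
      · rw [hτlt y hym] at h1
        order
      · omega
    rw [hτge x hx', hτge y (by omega)] at h1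
    rw [hτge x hx', hτge z (by omega)] at h2
    have := hiff ⟨0, by omega⟩
    have := hiff y
    refine h ⟨0, by omega⟩ x y z ?_ hxy hyz ?_ h1 h2 <;> rw [Fin.lt_def] <;>
      dsimp only at * <;> omega

lemma eq_of_mul_eq {σ τ σ' τ' : Perm (Fin n)} (hσ : Avoids132 σ) (hτ : Avoids213 τ)
    (hσ' : Avoids132 σ') (hτ' : Avoids213 τ') (hn : invCount σ + invCount τ + 2 ≤ n)
    (hinv : invCount σ + invCount τ = invCount σ' + invCount τ')
    (hle : invCount σ ≤ invCount σ') (h : σ * τ = σ' * τ') : σ = σ' := by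
  have key : ∀ x : Fin n, (x : ℕ) < invCount σ + 1 → σ x = σ' x := by
    intro x hx
    have := congrArg (· x) h
    simp only [Perm.mul_apply] at this
    rwa [hτ.apply_eq_of_add_invCount_lt x (by omega),
      hτ'.apply_eq_of_add_invCount_lt x (by omega)] at this
  have hfix : ∀ x : Fin n, invCount σ + 1 ≤ x → σ x = x := hσ.apply_eq_of_invCount_lt
  have hs : SplitsAt σ' (invCount σ + 1) := fun x hx =>
    key x hx ▸ splitsAt_of_fixes_ge hfix x hx
  ext1 x
  rcases lt_or_ge (x : ℕ) (invCount σ + 1) with hx | hx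
  · exact key x hx
  · rw [hfix x hx, hσ'.apply_eq_of_splitsAt (by omega) hs x hx]

lemma card_avoids_p1324_eq_card_pairs {k : ℕ} (hn : k + 2 ≤ n) :
    Nat.card {π : Perm (Fin n) // invCount π = k ∧ Avoids π p1324} =
      Nat.card {q : Perm (Fin n) × Perm (Fin n) //
        Avoids132 q.1 ∧ Avoids213 q.2 ∧ invCount q.1 + invCount q.2 = k} := by
  have hfix : ∀ {σ τ : Perm (Fin n)}, Avoids132 σ → Avoids213 τ →
      invCount σ + invCount τ = k → (∀ x : Fin n, invCount σ + 1 ≤ x → σ x = x) ∧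
        ∀ x : Fin n, (x : ℕ) < invCount σ + 1 → τ x = x := fun hσ hτ hk =>
    ⟨hσ.apply_eq_of_invCount_lt, fun x hx => hτ.apply_eq_of_add_invCount_lt x (by omega)⟩
  symm
  refine Nat.card_eq_of_bijective (fun q => ⟨q.1.1 * q.1.2, ?_, ?_⟩) ⟨?_, ?_⟩
  · obtain ⟨h1, h2⟩ := hfix q.2.1 q.2.2.1 q.2.2.2
    exact (invCount_mul h1 h2).trans q.2.2.2
  · obtain ⟨h1, h2⟩ := hfix q.2.1 q.2.2.1 q.2.2.2
    exact avoids_p1324_mul h1 h2 q.2.1 q.2.2.1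
  · rintro ⟨⟨σ, τ⟩, hσ, hτ, hk⟩ ⟨⟨σ', τ'⟩, hσ', hτ', hk'⟩ h
    dsimp only at hσ hτ hk hσ' hτ' hk'
    have hmul : σ * τ = σ' * τ' := congrArg Subtype.val h
    obtain rfl : σ = σ' := by
      rcases le_total (invCount σ) (invCount σ') with hle | hle
      · exact eq_of_mul_eq hσ hτ hσ' hτ' (by omega) (by omega) hle hmul
      · exact (eq_of_mul_eq hσ' hτ' hσ hτ (by omega) (by omega) hle hmul.symm).symm
    obtain rfl := mul_left_cancel hmul
    rfl
  · rintro ⟨π, hk, hπ⟩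
    obtain ⟨m, h1, h2, hs⟩ := exists_splitsAt (Nat.lt_succ_self (invCount π))
    obtain ⟨σ, τ, hσ, hτ, hinv, hmul⟩ := exists_mul_eq_of_splitsAt h1 (by omega) hs hπ
    exact ⟨⟨(σ, τ), hσ, hτ, hinv.trans hk⟩, Subtype.ext hmul⟩

open scoped Classical in
lemma card_pairs_eq_sum (k : ℕ) :
    Nat.card {q : Perm (Fin n) × Perm (Fin n) //
        Avoids132 q.1 ∧ Avoids213 q.2 ∧ invCount q.1 + invCount q.2 = k} =
      ∑ i ∈ range (k + 1), Nat.card {σ : Perm (Fin n) // Avoids132 σ ∧ invCount σ = i} *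
        Nat.card {τ : Perm (Fin n) // Avoids213 τ ∧ invCount τ = k - i} := by
  simp only [Nat.card_eq_fintype_card, Fintype.card_subtype]
  rw [card_eq_sum_card_fiberwise (f := fun q => invCount q.1) (t := range (k + 1))]
  · refine sum_congr rfl fun i hi => ?_
    rw [← card_product]
    congr 1
    ext ⟨σ, τ⟩
    rw [mem_range] at hi
    simp only [mem_filter, mem_univ, true_and, mem_product]
    constructor
    · rintro ⟨⟨h1, h2, h3⟩, h4⟩
      exact ⟨⟨h1, h4⟩, h2, by omega⟩
    · rintro ⟨⟨h1, h2⟩, h3, h4⟩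
      exact ⟨⟨h1, h3, by omega⟩, h2⟩
  · rintro ⟨σ, τ⟩ h
    simp only [coe_filter, mem_univ, true_and, Set.mem_ofPred_eq] at h
    simp only [coe_range, Set.mem_Iio]
    omega

end

/-- For every `k ≥ 0` and every `n ≥ k + 2`, the number of permutations of length `n` with
exactly `k` inversions avoiding both 1324 and 2413 equals the number avoiding 1324 alone,
and both equal `Σ_{i=0}^{k} p(i)·p(k−i)`, where `p(j)` is the number of integer
partitions of `j`. -/
theorem av_1324_2413_eq (k n : ℕ) (hn : k + 2 ≤ n) :
    Nat.card {π : Equiv.Perm (Fin n) // invCount π = k ∧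
        Avoids π p1324 ∧ Avoids π p2413} =
      Nat.card {π : Equiv.Perm (Fin n) // invCount π = k ∧ Avoids π p1324} ∧
    Nat.card {π : Equiv.Perm (Fin n) // invCount π = k ∧ Avoids π p1324} =
      ∑ i ∈ Finset.range (k + 1),
        Nat.card (Nat.Partition i) * Nat.card (Nat.Partition (k - i)) := by
  refine ⟨Nat.card_congr (Equiv.subtypeEquivRight fun π => ?_), ?_⟩
  · refine ⟨fun h => ⟨h.1, h.2.1⟩, fun h => ⟨h.1, h.2, ?_⟩⟩
    obtain ⟨m, h1, h2, hs⟩ := exists_splitsAt (Nat.lt_succ_self (invCount π))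
    exact avoids_p2413_of_splitsAt h1 (by omega) hs h.2
  · rw [card_avoids_p1324_eq_card_pairs hn, card_pairs_eq_sum]
    refine Finset.sum_congr rfl fun i hi => ?_
    rw [Finset.mem_range] at hi
    rw [card_avoids132_eq_card_partition (by omega), card_avoids213_eq_card_partition (by omega)]
end
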